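/- arXiv:1502.03991 — 2 statements merged into one kernel-verified Lean document; each statement's English description precedes it below -/
import Mathlib

section
/- The number of reduced pipe dreams for the permutation w = 1 n (n-1) ... 2 in S_n equals the Catalan number C_{n-1}. -/
/-!  Pipe dreams and Grothendieck polynomials.  Permutations of `S_n` are modeled as
permutations of `ℕ` fixing every `i ≥ n` (acting on `{0,…,n-1}`). -/

attribute [local instance] Classical.propDecidable

/-- Coxeter length = number of inversions on `{0,…,n-1}`. -/
def permLen (n : ℕ) (w : Equiv.Perm ℕ) : ℕ :=
  ((Finset.range n ×ˢ Finset.range n).filter (fun p => p.1 < p.2 ∧ w p.2 < w p.1)).card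

/-- Boxes of the staircase shape (0-indexed): `(r,c)` with `r + c ≤ n - 2`. -/
def boxes (n : ℕ) : Finset (ℕ × ℕ) :=
  ((Finset.range n) ×ˢ (Finset.range n)).filter (fun b => b.1 + b.2 + 2 ≤ n)

/-- The triangular word, as the list of boxes read row by row, each row right to left.
The box `(r,c)` carries the simple reflection `s_{r+c}` (0-indexed). -/
def triWord (n : ℕ) : List (ℕ × ℕ) :=
  (List.range (n - 1)).flatMap (fun r => ((List.range (n - 1 - r)).reverse).map (fun c => (r, c)))

/-- Demazure (0-Hecke) product of the simple reflections sitting in the boxes of `S`,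
read along the triangular word. -/
noncomputable def demazure (n : ℕ) (S : Finset (ℕ × ℕ)) : Equiv.Perm ℕ :=
  ((triWord n).filter (fun b => decide (b ∈ S))).foldl
    (fun u b =>
      let v := u * Equiv.swap (b.1 + b.2) (b.1 + b.2 + 1)
      if permLen n u < permLen n v then v else u) 1

/-- A (possibly nonreduced) pipe dream for `w ∈ S_n`: a set of crosses in the staircase whose
pipes intertwine according to `w` (extra crossings of a pair of pipes being ignored). -/
def IsPipeDream (n : ℕ) (w : Equiv.Perm ℕ) (P : Finset (ℕ × ℕ)) : Prop :=
  P ⊆ boxes n ∧ demazure n P = w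

/-- A reduced pipe dream: a pipe dream with exactly `ℓ(w)` crosses. -/
def IsReducedPipeDream (n : ℕ) (w : Equiv.Perm ℕ) (P : Finset (ℕ × ℕ)) : Prop :=
  IsPipeDream n w P ∧ P.card = permLen n w

/-- All pipe dreams of `w` (reduced and nonreduced), as a finite set. -/
noncomputable def pipeDreams (n : ℕ) (w : Equiv.Perm ℕ) : Finset (Finset (ℕ × ℕ)) :=
  (boxes n).powerset.filter (fun P => demazure n P = w)

/-- The permutation `1 n (n-1) ⋯ 2 ∈ S_n` (0-indexed: `0 ↦ 0` and `i ↦ n - i` for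
`1 ≤ i ≤ n-1`, identity elsewhere); it is an involution. -/
def piPerm (n : ℕ) : Equiv.Perm ℕ :=
  Function.Involutive.toPerm (fun i => if 1 ≤ i ∧ i < n then n - i else i)
    (by intro i; dsimp only; split_ifs <;> omega)

open Polynomial

/-- Generating polynomial, by number of omitted letters, of the subwords of a word in the simple
transpositions of `ℕ` whose product is `x`. -/
noncomputable def subwordPoly : List ℕ → Equiv.Perm ℕ → ℕ[X]
  | [], x => if x = 1 then 1 else 0
  | k :: L, x => X * subwordPoly L x + subwordPoly L (Equiv.swap k (k + 1) * x)

/-- The word `a + k - 1, …, a + 1, a`. -/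
def rowWord (a : ℕ) : ℕ → List ℕ
  | 0 => []
  | k + 1 => (a + k) :: rowWord a k

/-- The triangular word on the `m` points `a, …, a + m - 1`. -/
def stairWord : ℕ → ℕ → List ℕ
  | _, 0 => []
  | a, m + 1 => rowWord a m ++ stairWord (a + 1) m

/-- The list `o + c, …, o + 1`. -/
def descList (o : ℕ) : ℕ → List ℕ
  | 0 => []
  | c + 1 => (o + c + 1) :: descList o c

/-- Total size of a list of blocks, where the entry `c` stands for a block of size `c + 1`. -/
def blockSize : List ℕ → ℕ
  | [] => 0
  | c :: B => c + 1 + blockSize B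

/-- One-line notation, with values starting at `o`, of the skew sum of the permutations
`1 (c+1) c ⋯ 2`, for `c` in the given list. -/
def skewWord (o : ℕ) : List ℕ → List ℕ
  | [] => []
  | c :: B => (o + blockSize B) :: (descList (o + blockSize B) c ++ skewWord o B)

/-- Product of the weights `catalan c * X ^ c` over a list of blocks. -/
noncomputable def blockWeight : List ℕ → ℕ[X]
  | [] => 1
  | c :: B => (C (catalan c) * X ^ c) * blockWeight B

/-- Partial Catalan convolution. -/
def catalanConv (d e : ℕ) : ℕ :=
  ∑ j ∈ Finset.range (e + 1), catalan (d + j) * catalan (e - j)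

/-- The cycle `a + k ↦ a`, `v ↦ v + 1` for `a ≤ v < a + k`. -/
def shiftCycle (a : ℕ) : ℕ → Equiv.Perm ℕ
  | 0 => 1
  | k + 1 => shiftCycle a k * Equiv.swap (a + k) (a + k + 1)

theorem catalanConv_zero_right (d : ℕ) : catalanConv d 0 = catalan d := by
  simp [catalanConv]

theorem catalanConv_zero_left (e : ℕ) : catalanConv 0 e = catalan (e + 1) := by
  rw [catalan_succ, catalanConv, Finset.sum_range]
  simp

theorem catalanConv_succ (d e : ℕ) :
    catalanConv d (e + 1) = catalanConv (d + 1) e + catalan d * catalan (e + 1) := by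
  rw [catalanConv, Finset.sum_range_succ', catalanConv]
  congr 1
  refine Finset.sum_congr rfl fun j _ => ?_
  congr 2 <;> omega

theorem mem_rowWord {a k v : ℕ} (h : v ∈ rowWord a k) : a ≤ v := by
  induction k with
  | zero => simp [rowWord] at h
  | succ k ih =>
    rcases List.mem_cons.1 h with h | h
    · omega
    · exact ih h

theorem mem_stairWord {a m v : ℕ} (h : v ∈ stairWord a m) : a ≤ v := by
  induction m generalizing a with
  | zero => simp [stairWord] at h
  | succ m ih =>
    rcases List.mem_append.1 h with h | h
    · exact mem_rowWord h
    · have := ih h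
      omega

theorem mem_descList {o c v : ℕ} (h : v ∈ descList o c) : o < v ∧ v ≤ o + c := by
  induction c with
  | zero => simp [descList] at h
  | succ c ih =>
    rcases List.mem_cons.1 h with h | h
    · omega
    · have := ih h
      omega

theorem descList_succ_concat (o c : ℕ) :
    descList o (c + 1) = descList (o + 1) c ++ [o + 1] := by
  induction c with
  | zero => simp [descList]
  | succ c ih =>
    rw [descList, ih, descList]
    simp
    omega

theorem mem_skewWord {o v : ℕ} {B : List ℕ} (h : v ∈ skewWord o B) :
    o ≤ v ∧ v < o + blockSize B := by
  induction B with
  | nil => simp [skewWord] at h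
  | cons c B ih =>
    simp only [skewWord, List.mem_cons, List.mem_append] at h
    simp only [blockSize]
    rcases h with h | h | h
    · omega
    · have := mem_descList h
      omega
    · have := ih h
      omega

theorem map_succ_descList (o c : ℕ) :
    (descList o c).map (· + 1) = descList (o + 1) c := by
  induction c with
  | zero => rfl
  | succ c ih =>
    simp only [descList, List.map_cons, ih, List.cons.injEq, and_true]
    omega

theorem map_succ_skewWord (o : ℕ) (B : List ℕ) :
    (skewWord o B).map (· + 1) = skewWord (o + 1) B := by
  induction B with
  | nil => rfl
  | cons c B ih =>
    simp only [skewWord, List.map_cons, List.map_append, ih, map_succ_descList,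
      Nat.add_right_comm o _ 1]

theorem blockSize_append (D B : List ℕ) :
    blockSize (D ++ B) = blockSize D + blockSize B := by
  induction D with
  | nil => simp [blockSize]
  | cons c D ih =>
    simp only [List.cons_append, blockSize, ih]
    omega

theorem blockWeight_append (D B : List ℕ) :
    blockWeight (D ++ B) = blockWeight D * blockWeight B := by
  induction D with
  | nil => simp [blockWeight]
  | cons c D ih => simp only [List.cons_append, blockWeight, ih, mul_assoc]

theorem skewWord_append (o : ℕ) (D B : List ℕ) :
    skewWord o (D ++ B) = skewWord (o + blockSize B) D ++ skewWord o B := by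
  induction D with
  | nil => simp [skewWord]
  | cons c D ih =>
    have : o + (blockSize D + blockSize B) = o + blockSize B + blockSize D := by omega
    simp only [List.cons_append, skewWord, blockSize_append, ih, List.append_assoc, this]

theorem shiftCycle_apply_of_lt {a k v : ℕ} (hv : a + k < v) : shiftCycle a k v = v := by
  induction k with
  | zero => rfl
  | succ k ih =>
    rw [shiftCycle, Equiv.Perm.mul_apply, Equiv.swap_apply_of_ne_of_ne (by omega) (by omega)]
    exact ih (by omega)

theorem shiftCycle_apply_of_lt_left {a k v : ℕ} (hv : v < a) : shiftCycle a k v = v := by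
  induction k with
  | zero => rfl
  | succ k ih =>
    rw [shiftCycle, Equiv.Perm.mul_apply, Equiv.swap_apply_of_ne_of_ne (by omega) (by omega), ih]

theorem shiftCycle_apply_top (a k : ℕ) : shiftCycle a k (a + k) = a := by
  induction k with
  | zero => rfl
  | succ k ih =>
    rw [shiftCycle, Equiv.Perm.mul_apply, ← add_assoc, Equiv.swap_apply_right, ih]

theorem shiftCycle_apply {a k v : ℕ} (hv : a ≤ v) (hk : v < a + k) :
    shiftCycle a k v = v + 1 := by
  induction k with
  | zero => omega
  | succ k ih =>
    rw [shiftCycle, Equiv.Perm.mul_apply]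
    rcases Nat.lt_or_ge v (a + k) with h | h
    · rw [Equiv.swap_apply_of_ne_of_ne (by omega) (by omega), ih h]
    · obtain rfl : v = a + k := by omega
      rw [Equiv.swap_apply_left, shiftCycle_apply_of_lt (by omega)]

theorem subwordPoly_eq_zero {a : ℕ} {L : List ℕ} (hL : ∀ k ∈ L, a < k) {x : Equiv.Perm ℕ}
    (hx : x a ≠ a) : subwordPoly L x = 0 := by
  induction L generalizing x with
  | nil =>
    rw [subwordPoly, if_neg]
    rintro rfl
    exact hx rfl
  | cons k L ih =>
    have hk := hL k (by simp)
    have hL' : ∀ k ∈ L, a < k := fun j hj => hL j (by simp [hj])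
    rw [subwordPoly, ih hL' hx, ih hL', mul_zero, add_zero]
    rw [Equiv.Perm.mul_apply, Equiv.swap_apply_def]
    split_ifs <;> omega

theorem subwordPoly_rowWord_eq_zero {a k : ℕ} {L : List ℕ} (hL : ∀ j ∈ L, a < j)
    {x : Equiv.Perm ℕ} (hx : a + k < x a) : subwordPoly (rowWord a k ++ L) x = 0 := by
  induction k generalizing x with
  | zero => exact subwordPoly_eq_zero hL (by omega)
  | succ k ih =>
    rw [rowWord, List.cons_append, subwordPoly, ih (by omega), ih, mul_zero, add_zero]
    rw [Equiv.Perm.mul_apply, Equiv.swap_apply_of_ne_of_ne (by omega) (by omega)]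
    omega

theorem subwordPoly_rowWord {a k : ℕ} {L : List ℕ} (hL : ∀ j ∈ L, a < j)
    {x : Equiv.Perm ℕ} (hx : x a = a + k) :
    subwordPoly (rowWord a k ++ L) x = subwordPoly L (shiftCycle a k * x) := by
  induction k generalizing x with
  | zero => simp [rowWord, shiftCycle]
  | succ k ih =>
    rw [rowWord, List.cons_append, subwordPoly, subwordPoly_rowWord_eq_zero hL (by omega),
      ih, mul_zero, zero_add, shiftCycle, mul_assoc]
    rw [Equiv.Perm.mul_apply, hx, ← add_assoc, Equiv.swap_apply_right]

theorem map_range'_mul (s x : Equiv.Perm ℕ) (a m : ℕ) :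
    (List.range' a m).map (s * x) = ((List.range' a m).map x).map s := by
  simp

theorem map_eq_self {l : List ℕ} {f : ℕ → ℕ} (h : ∀ v ∈ l, f v = v) : l.map f = l := by
  conv_rhs => rw [← List.map_id l]
  exact List.map_congr_left h

theorem map_shiftCycle_skewWord (a : ℕ) (B : List ℕ) :
    (skewWord a B).map (shiftCycle a (blockSize B)) = skewWord (a + 1) B := by
  rw [← map_succ_skewWord]
  refine List.map_congr_left fun v hv => ?_
  have := mem_skewWord hv
  exact shiftCycle_apply this.1 this.2

/-- The evaluation of `subwordPoly` on triangular words of size `m` at skew sums. -/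
def SkewEvaluation (m : ℕ) : Prop :=
  ∀ (a : ℕ) (B : List ℕ) (x : Equiv.Perm ℕ), blockSize B = m →
    (List.range' a m).map x = skewWord a B → (∀ p < a, x p = p) → (∀ p, a + m ≤ p → x p = p) →
    subwordPoly (stairWord a m) x = blockWeight B

theorem SkewEvaluation.of_row_end {m : ℕ} (hm : SkewEvaluation m) {a : ℕ} {D B : List ℕ}
    {x : Equiv.Perm ℕ} (hDB : blockSize (D ++ B) = m)
    (hx : (List.range' a (m + 1)).map x =
      (a + blockSize B) :: (skewWord (a + 1 + blockSize B) D ++ skewWord a B))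
    (hlt : ∀ p < a, x p = p) (hge : ∀ p, a + (m + 1) ≤ p → x p = p) :
    subwordPoly (rowWord a (blockSize B) ++ stairWord (a + 1) m) x = blockWeight (D ++ B) := by
  rw [List.range'_succ, List.map_cons, List.cons.injEq] at hx
  obtain ⟨hxa, hx⟩ := hx
  rw [blockSize_append] at hDB
  rw [subwordPoly_rowWord (fun j hj => mem_stairWord hj) hxa]
  refine hm _ _ _ (by rw [blockSize_append]; exact hDB) ?_ ?_ ?_
  · rw [map_range'_mul, hx, List.map_append, map_shiftCycle_skewWord, skewWord_append]
    congr 1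
    refine map_eq_self fun v hv => shiftCycle_apply_of_lt ?_
    have := mem_skewWord hv
    omega
  · intro p hp
    rw [Equiv.Perm.mul_apply]
    rcases Nat.lt_or_ge p a with h | h
    · rw [hlt p h, shiftCycle_apply_of_lt_left h]
    · obtain rfl : p = a := by omega
      rw [hxa, shiftCycle_apply_top]
  · intro p hp
    rw [Equiv.Perm.mul_apply, hge p (by omega), shiftCycle_apply_of_lt (by omega)]

theorem SkewEvaluation.of_row {m : ℕ} (hm : SkewEvaluation m) {a : ℕ} (B : List ℕ) (e : ℕ) :
    ∀ (D : List ℕ) (d : ℕ) (x : Equiv.Perm ℕ),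
      blockSize D + (d + 1) + e + blockSize B = m →
      (List.range' a (m + 1)).map x =
        (a + blockSize B) :: (skewWord (a + 1 + blockSize B + e + (d + 1)) D ++
          ((a + 1 + blockSize B + e) :: (descList (a + 1 + blockSize B + e) d ++
            (descList (a + blockSize B) e ++ skewWord a B)))) →
      (∀ p < a, x p = p) → (∀ p, a + (m + 1) ≤ p → x p = p) →
      subwordPoly (rowWord a (blockSize B + e + 1) ++ stairWord (a + 1) m) x =
        blockWeight D * (C (catalanConv d e) * X ^ (d + 1 + e)) * blockWeight B := by
  induction e with
  | zero =>
    intro D d x hsize hx hlt hge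
    have hxa : x a = a + blockSize B := by
      rw [List.range'_succ, List.map_cons, List.cons.injEq] at hx
      exact hx.1
    rw [add_zero, rowWord, List.cons_append, subwordPoly]
    rw [subwordPoly_rowWord_eq_zero (x := Equiv.swap _ _ * x) (fun j hj => mem_stairWord hj)
      (by rw [Equiv.Perm.mul_apply, hxa, Equiv.swap_apply_left]; omega)]
    have key := hm.of_row_end (a := a) (D := D ++ [d]) (B := B) (x := x)
      (by simp only [blockSize_append, blockSize]; omega)
      (by rw [hx, skewWord_append]; simp [skewWord, descList, blockSize]) hlt hge
    rw [key, catalanConv_zero_right]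
    simp only [blockWeight_append, blockWeight]
    ring
  | succ e ih =>
    intro D d x hsize hx hlt hge
    set t := blockSize B
    rw [show t + (e + 1) + 1 = (t + e + 1) + 1 by omega, rowWord, List.cons_append, subwordPoly]
    rw [ih (D ++ [d]) 0 x, ih D (d + 1)]
    · rw [catalanConv_succ, catalanConv_zero_left]
      simp only [blockWeight_append, blockWeight, C_add, C_mul]
      ring
    · omega
    · rw [map_range'_mul, hx]
      have e1 : a + 1 + t + (e + 1) + (d + 1) = a + 1 + t + e + (d + 1 + 1) := by omega
      have e2 : a + 1 + t + (e + 1) = a + (t + e + 1) + 1 := by omega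
      have e3 : a + t + e + 1 = a + (t + e + 1) := by omega
      have e4 : a + 1 + t + e = a + (t + e + 1) := by omega
      have hfix : ∀ v, (v < a + (t + e + 1) ∨ a + (t + e + 1) + 1 < v) →
          Equiv.swap (a + (t + e + 1)) (a + (t + e + 1) + 1) v = v := fun v hv =>
        Equiv.swap_apply_of_ne_of_ne (by omega) (by omega)
      rw [descList_succ_concat _ d, e1, e2, e4, descList, e3]
      simp only [List.map_cons, List.map_append, Equiv.swap_apply_left, Equiv.swap_apply_right]
      rw [hfix _ (by omega), map_eq_self, map_eq_self, map_eq_self, map_eq_self]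
      · simp
      · intro v hv
        have := mem_skewWord hv
        exact hfix v (by omega)
      · intro v hv
        have := mem_descList hv
        exact hfix v (by omega)
      · intro v hv
        have := mem_descList hv
        exact hfix v (by omega)
      · intro v hv
        have := mem_skewWord hv
        exact hfix v (by omega)
    · intro p hp
      rw [Equiv.Perm.mul_apply, hlt p hp, Equiv.swap_apply_of_ne_of_ne (by omega) (by omega)]
    · intro p hp
      rw [Equiv.Perm.mul_apply, hge p hp, Equiv.swap_apply_of_ne_of_ne (by omega) (by omega)]
    · simp only [blockSize_append, blockSize]
      omega
    · rw [hx, skewWord_append]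
      have e1 : a + 1 + t + e + (0 + 1) = a + 1 + t + (e + 1) := by omega
      have e2 : a + t + e + 1 = a + 1 + t + e := by omega
      simp [skewWord, descList, blockSize, e1, e2]
    · exact hlt
    · exact hge

theorem skewEvaluation (m : ℕ) : SkewEvaluation m := by
  induction m with
  | zero =>
    intro a B x hB _ hlt hge
    have hx : x = 1 := by
      ext p
      rcases Nat.lt_or_ge p a with h | h
      · exact hlt p h
      · exact hge p h
    cases B with
    | nil => simp [stairWord, subwordPoly, blockWeight, hx]
    | cons c B => simp only [blockSize] at hB; omega
  | succ m ih =>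
    intro a B x hB hx hlt hge
    rcases B with _ | ⟨c, B⟩
    · simp [blockSize] at hB
    · simp only [blockSize] at hB
      rw [stairWord]
      rcases c with _ | c
      · obtain rfl : m = blockSize B := by omega
        have := ih.of_row_end (D := []) (B := B) rfl (by simpa [skewWord, descList] using hx)
          hlt hge
        simpa [blockWeight] using this
      · have := ih.of_row B c [] 0 x (by simp only [blockSize]; omega)
          (by
            rw [hx]
            have : a + blockSize B + c + 1 = a + 1 + blockSize B + c := by omega
            simp [skewWord, descList, this]) hlt hge
        obtain rfl : m = blockSize B + c + 1 := by omega
        rw [this, catalanConv_zero_left]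
        simp only [blockWeight]
        ring

theorem descList_eq_map (o c : ℕ) :
    descList o c = (List.range c).map (fun i => o + c - i) := by
  induction c with
  | zero => rfl
  | succ c ih =>
    rw [descList, List.range_succ_eq_map, List.map_cons, ih, List.map_map]
    congr 1
    refine List.map_congr_left fun i _ => ?_
    simp only [Function.comp_apply]
    omega

theorem piPerm_apply (n i : ℕ) : piPerm n i = if 1 ≤ i ∧ i < n then n - i else i := rfl

theorem subwordPoly_piPerm (n : ℕ) :
    subwordPoly (stairWord 0 n) (piPerm n) = C (catalan (n - 1)) * X ^ (n - 1) := by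
  have h0 : ∀ p < 0, piPerm n p = p := fun p hp => absurd hp p.not_lt_zero
  have hge : ∀ p, 0 + n ≤ p → piPerm n p = p := fun p hp => by
    rw [piPerm_apply, if_neg (by omega)]
  rcases n with _ | n
  · simpa [blockWeight] using skewEvaluation 0 0 [] (piPerm 0) rfl rfl h0 hge
  · have := skewEvaluation (n + 1) 0 [n] (piPerm (n + 1)) rfl ?_ h0 hge
    · simpa [blockWeight] using this
    · rw [List.range'_succ, List.map_cons, piPerm_apply, if_neg (by omega), List.range'_eq_map_range,
        List.map_map]
      simp only [skewWord, blockSize, descList_eq_map, List.append_nil]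
      congr 1
      refine List.map_congr_left fun i hi => ?_
      have := List.mem_range.1 hi
      rw [Function.comp_apply, piPerm_apply, if_pos (by omega)]
      omega

theorem permLen_one (n : ℕ) : permLen n 1 = 0 := by
  rw [permLen, Finset.card_eq_zero, Finset.filter_eq_empty_iff]
  rintro p - ⟨h1, h2⟩
  simp only [Equiv.Perm.one_apply] at h2
  omega

theorem permLen_mul_swap_le {n k : ℕ} (hk : k + 1 < n) (u : Equiv.Perm ℕ) :
    permLen n (u * Equiv.swap k (k + 1)) ≤ permLen n u + 1 := by
  rw [permLen, permLen, ← Nat.sub_le_iff_le_add]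
  refine (Finset.pred_card_le_card_erase (a := (k, k + 1))).trans ?_
  refine Finset.card_le_card_of_injOn
    (fun p => (Equiv.swap k (k + 1) p.1, Equiv.swap k (k + 1) p.2)) ?_ ?_
  · rintro ⟨i, j⟩ hp
    rw [Finset.mem_coe, Finset.mem_erase, Finset.mem_filter] at hp
    rw [Finset.mem_coe, Finset.mem_filter]
    simp only [Finset.mem_product, Finset.mem_range, ne_eq, Prod.mk.injEq,
      Equiv.Perm.mul_apply] at hp ⊢
    obtain ⟨hne, ⟨hi, hj⟩, hij, hu⟩ := hp
    refine ⟨?_, ?_, hu⟩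
    · constructor <;> rw [Equiv.swap_apply_def] <;> split_ifs <;> omega
    · rw [Equiv.swap_apply_def, Equiv.swap_apply_def]
      split_ifs <;> omega
  · rintro ⟨i, j⟩ - ⟨i', j'⟩ - h
    simpa using h

/-- The product of the simple transpositions indexed by a word. -/
def wordProd (L : List ℕ) : Equiv.Perm ℕ :=
  (L.map fun k => Equiv.swap k (k + 1)).prod

theorem wordProd_cons (k : ℕ) (L : List ℕ) :
    wordProd (k :: L) = Equiv.swap k (k + 1) * wordProd L := by
  simp [wordProd]

/-- One step of the Demazure product. -/
noncomputable def demazureStep (n : ℕ) (u : Equiv.Perm ℕ) (k : ℕ) : Equiv.Perm ℕ :=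
  if permLen n u < permLen n (u * Equiv.swap k (k + 1)) then u * Equiv.swap k (k + 1) else u

theorem permLen_mul_wordProd_le {n : ℕ} {L : List ℕ} (hL : ∀ k ∈ L, k + 1 < n)
    (u : Equiv.Perm ℕ) : permLen n (u * wordProd L) ≤ permLen n u + L.length := by
  induction L generalizing u with
  | nil => simp [wordProd]
  | cons k L ih =>
    have h1 := ih (fun j hj => hL j (by simp [hj])) (u * Equiv.swap k (k + 1))
    have h2 := permLen_mul_swap_le (hL k (by simp)) u
    rw [wordProd_cons, ← mul_assoc, List.length_cons]
    omega

theorem permLen_foldl_demazureStep_le {n : ℕ} {L : List ℕ} (hL : ∀ k ∈ L, k + 1 < n)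
    (u : Equiv.Perm ℕ) : permLen n (L.foldl (demazureStep n) u) ≤ permLen n u + L.length := by
  induction L generalizing u with
  | nil => simp
  | cons k L ih =>
    have h1 := ih (fun j hj => hL j (by simp [hj])) (demazureStep n u k)
    have h2 := permLen_mul_swap_le (hL k (by simp)) u
    have h3 : permLen n (demazureStep n u k) ≤ permLen n u + 1 := by
      rw [demazureStep]
      split_ifs <;> omega
    rw [List.foldl_cons, List.length_cons]
    omega

theorem foldl_demazureStep_eq_iff {n : ℕ} {L : List ℕ} (hL : ∀ k ∈ L, k + 1 < n)
    {u w : Equiv.Perm ℕ} (hw : permLen n w = permLen n u + L.length) :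
    L.foldl (demazureStep n) u = w ↔ u * wordProd L = w := by
  induction L generalizing u with
  | nil => simp [wordProd]
  | cons k L ih =>
    have hL' : ∀ j ∈ L, j + 1 < n := fun j hj => hL j (by simp [hj])
    have h2 := permLen_mul_swap_le (hL k (by simp)) u
    rw [wordProd_cons, ← mul_assoc, List.foldl_cons]
    rw [List.length_cons] at hw
    by_cases h : permLen n u < permLen n (u * Equiv.swap k (k + 1))
    · rw [demazureStep, if_pos h]
      exact ih hL' (by omega)
    · rw [demazureStep, if_neg h]
      refine iff_of_false ?_ ?_
      · rintro rfl
        have := permLen_foldl_demazureStep_le hL' u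
        omega
      · rintro rfl
        have := permLen_mul_wordProd_le hL' (u * Equiv.swap k (k + 1))
        omega

theorem subwordPoly_map_eq_sum {α : Type*} [DecidableEq α] (f : α → ℕ) {L : List α}
    (hL : L.Nodup) (x : Equiv.Perm ℕ) :
    subwordPoly (L.map f) x = ∑ P ∈ L.toFinset.powerset,
      if wordProd ((L.filter (fun b => decide (b ∈ P))).map f) = x then
        X ^ (L.length - P.card) else 0 := by
  induction L generalizing x with
  | nil => simp [subwordPoly, wordProd, eq_comm]
  | cons b L ih =>
    obtain ⟨hb, hL⟩ := List.nodup_cons.1 hL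
    have hb' : b ∉ L.toFinset := by simpa using hb
    rw [List.map_cons, subwordPoly, List.toFinset_cons, Finset.sum_powerset_insert hb', ih hL,
      ih hL, Finset.mul_sum]
    congr 1
    · refine Finset.sum_congr rfl fun P hP => ?_
      have hPL := Finset.mem_powerset.1 hP
      have hbP : b ∉ P := fun h => hb' (hPL h)
      have hcard := (Finset.card_le_card hPL).trans L.toFinset_card_le
      rw [List.filter_cons_of_neg (by simpa using hbP), List.length_cons,
        Nat.succ_sub hcard, mul_ite, mul_zero, pow_succ']
    · refine Finset.sum_congr rfl fun P hP => ?_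
      have hPL := Finset.mem_powerset.1 hP
      have hbP : b ∉ P := fun h => hb' (hPL h)
      have hfilter : L.filter (fun c => decide (c ∈ insert b P)) =
          L.filter (fun c => decide (c ∈ P)) := by
        refine List.filter_congr fun c hc => ?_
        have : c ≠ b := fun h => hb (h ▸ hc)
        simp [this]
      rw [List.filter_cons_of_pos (by simp), hfilter, List.map_cons, wordProd_cons,
        Finset.card_insert_of_notMem hbP, List.length_cons, Nat.add_sub_add_right]
      congr 1
      rw [eq_iff_iff, ← eq_inv_mul_iff_mul_eq, Equiv.swap_inv]

theorem rowWord_eq_map (a k : ℕ) :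
    rowWord a k = (List.range k).reverse.map (fun c => a + c) := by
  induction k with
  | zero => rfl
  | succ k ih => rw [rowWord, List.range_succ, List.reverse_append, ih]; simp

theorem stairWord_eq_flatMap (a m : ℕ) :
    stairWord a (m + 1) = (List.range m).flatMap (fun r => rowWord (a + r) (m - r)) := by
  induction m generalizing a with
  | zero => rfl
  | succ m ih =>
    rw [stairWord, ih, List.range_succ_eq_map, List.flatMap_cons, List.flatMap_map]
    simp [add_assoc, add_comm 1]

theorem map_triWord (n : ℕ) : (triWord n).map (fun b => b.1 + b.2) = stairWord 0 n := by
  rcases n with _ | n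
  · rfl
  · rw [stairWord_eq_flatMap, triWord, List.map_flatMap]
    simp [rowWord_eq_map, Function.comp_def]

theorem mem_triWord {n : ℕ} {b : ℕ × ℕ} : b ∈ triWord n ↔ b ∈ boxes n := by
  obtain ⟨r, c⟩ := b
  simp only [triWord, boxes, List.mem_flatMap, List.mem_range, List.mem_map, List.mem_reverse,
    Prod.mk.injEq, Finset.mem_filter, Finset.mem_product, Finset.mem_range]
  constructor
  · rintro ⟨r', hr, c', hc, rfl, rfl⟩
    omega
  · intro h
    exact ⟨r, by omega, c, by omega, rfl, rfl⟩

theorem nodup_triWord (n : ℕ) : (triWord n).Nodup := by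
  rw [triWord, List.nodup_flatMap]
  constructor
  · intro r _
    exact (List.nodup_reverse.2 List.nodup_range).map (fun c c' h => by simpa using h)
  · refine List.nodup_range.imp fun {r r'} h => ?_
    rw [Function.onFun, List.disjoint_left]
    intro b hb hb'
    simp only [List.mem_map] at hb hb'
    obtain ⟨c, _, rfl⟩ := hb
    obtain ⟨c', _, hc⟩ := hb'
    simp only [Prod.mk.injEq] at hc
    exact h hc.1.symm

theorem toFinset_triWord (n : ℕ) : (triWord n).toFinset = boxes n := by
  ext b
  rw [List.mem_toFinset, mem_triWord]

theorem length_triWord (n : ℕ) : (triWord n).length = (boxes n).card := by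
  rw [← toFinset_triWord, List.toFinset_card_of_nodup (nodup_triWord n)]

theorem card_boxes_eq_permLen_add (n : ℕ) :
    (boxes n).card = permLen n (piPerm n) + (n - 1) := by
  rw [← Finset.card_filter_add_card_filter_not (s := boxes n) (fun b => 1 ≤ b.1)]
  congr 1
  · rw [permLen]
    refine Finset.card_nbij' (fun b => (b.1, b.1 + b.2 + 1)) (fun p => (p.1, p.2 - p.1 - 1))
      ?_ ?_ ?_ ?_
    · rintro ⟨r, c⟩ h
      rw [Finset.mem_coe, Finset.mem_filter]
      simp [boxes, piPerm_apply] at h ⊢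
      split_ifs <;> omega
    · rintro ⟨i, j⟩ h
      rw [Finset.mem_coe, Finset.mem_filter] at h
      simp [boxes, piPerm_apply] at h ⊢
      split_ifs at h <;> omega
    · rintro ⟨r, c⟩ h
      simp
      omega
    · rintro ⟨i, j⟩ h
      have := (Finset.mem_filter.1 h).2.1
      simp
      omega
  · conv_rhs => rw [← Finset.card_range (n - 1)]
    refine Finset.card_nbij' (fun b => b.2) (fun c => (0, c)) ?_ ?_ ?_ ?_
    · rintro ⟨r, c⟩ h
      simp [boxes] at h ⊢
      omega
    · intro c h
      simp [boxes] at h ⊢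
      omega
    · rintro ⟨r, c⟩ h
      simp [boxes] at h ⊢
      omega
    · intro c h
      rfl

theorem demazure_eq_foldl (n : ℕ) (P : Finset (ℕ × ℕ)) :
    demazure n P = (((triWord n).filter (fun b => decide (b ∈ P))).map
      (fun b => b.1 + b.2)).foldl (demazureStep n) 1 := by
  rw [List.foldl_map]
  rfl

theorem length_filter_triWord {n : ℕ} {P : Finset (ℕ × ℕ)} (hP : P ⊆ boxes n) :
    ((triWord n).filter (fun b => decide (b ∈ P))).length = P.card := by
  rw [← List.toFinset_card_of_nodup ((nodup_triWord n).filter _), List.toFinset_filter,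
    toFinset_triWord]
  congr 1
  ext b
  simp only [Finset.mem_filter, decide_eq_true_eq]
  exact ⟨fun h => h.2, fun h => ⟨hP h, h⟩⟩

theorem isReducedPipeDream_iff {n : ℕ} {w : Equiv.Perm ℕ} {P : Finset (ℕ × ℕ)} :
    IsReducedPipeDream n w P ↔ P ⊆ boxes n ∧
      wordProd (((triWord n).filter (fun b => decide (b ∈ P))).map (fun b => b.1 + b.2)) = w ∧
      P.card = permLen n w := by
  rw [IsReducedPipeDream, IsPipeDream, and_assoc]
  refine and_congr_right fun hP => and_congr_left fun hcard => ?_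
  rw [demazure_eq_foldl, foldl_demazureStep_eq_iff, one_mul]
  · intro k hk
    obtain ⟨b, hb, rfl⟩ := List.mem_map.1 hk
    have := mem_triWord.1 (List.mem_of_mem_filter hb)
    simp only [boxes, Finset.mem_filter] at this
    omega
  · rw [permLen_one, List.length_map, length_filter_triWord hP, hcard, zero_add]

/-- The number of reduced pipe dreams of `1 n (n-1) ⋯ 2 ∈ S_n`
is the Catalan number `C_{n-1}`. -/
theorem card_reducedPipeDreams_eq_catalan (n : ℕ) :
    Nat.card {P : Finset (ℕ × ℕ) // IsReducedPipeDream n (piPerm n) P} =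
      catalan (n - 1) := by
  have h := subwordPoly_map_eq_sum (fun b : ℕ × ℕ => b.1 + b.2) (nodup_triWord n) (piPerm n)
  rw [map_triWord, subwordPoly_piPerm] at h
  replace h := congrArg (fun p => p.coeff (n - 1)) h
  simp only [coeff_C_mul_X_pow, if_true, finsetSum_coeff,
    apply_ite (fun p : ℕ[X] => p.coeff (n - 1)),
    coeff_X_pow, coeff_zero] at h
  rw [h]
  simp only [← ite_and, Finset.sum_boole, Nat.cast_id]
  rw [Nat.subtype_card]
  intro P
  rw [isReducedPipeDream_iff, Finset.mem_filter, Finset.mem_powerset, toFinset_triWord,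
    length_triWord, card_boxes_eq_permLen_add]
  refine and_congr_right fun hP => and_congr_right fun _ => ?_
  have h1 := Finset.card_le_card hP
  rw [card_boxes_eq_permLen_add] at h1
  omega
end

section
/- For any graph G on [n], the specialized reduced form Q_G(β) of the monomial prod_{(i,j) ∈ E(G)} x_{ij} in the subdivision algebra is well-defined: any two sequences of reductions terminating in a reduced form yield, after setting all x_{ij} = 1, the same polynomial in β. -/
open MvPolynomial

/-- The ambient polynomial ring `ℚ[β][x_{ij}]`: multivariate polynomials in the variables
`x_{ij}` (indexed by pairs) over `ℚ[β]` (where `β` is `Polynomial.X`). -/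
abbrev SubAlg : Type := MvPolynomial (ℕ × ℕ) (Polynomial ℚ)

/-- One reduction step of the subdivision algebra (with generators `x_{ij}`,
`1 ≤ i < j ≤ n`): some monomial of `p` is divisible by `x_{ij} x_{jk}` for some
`1 ≤ i < j < k ≤ n`, and that occurrence of `x_{ij} x_{jk}` is replaced by
`x_{ik}(x_{ij} + x_{jk} + β)`. -/
def ReductionStep (n : ℕ) (p q : SubAlg) : Prop :=
  ∃ i j k : ℕ, 1 ≤ i ∧ i < j ∧ j < k ∧ k ≤ n ∧
    ∃ d ∈ p.support, 1 ≤ d (i, j) ∧ 1 ≤ d (j, k) ∧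
      q = p + (monomial (d - Finsupp.single (i, j) 1 - Finsupp.single (j, k) 1)
          (p.coeff d)) *
        (X (i, k) * (X (i, j) + X (j, k) + C Polynomial.X) - X (i, j) * X (j, k))

/-- `q` is a reduced form of `p`: it is obtained from `p` by a finite sequence of reduction
steps and no further reduction is possible. -/
def IsReducedForm (n : ℕ) (p q : SubAlg) : Prop :=
  Relation.ReflTransGen (ReductionStep n) p q ∧ ∀ r, ¬ ReductionStep n q r

/-- Specialization at `x_{ij} = 1` for all `i < j`, landing in `ℚ[β]`. -/
noncomputable def specializeOne (p : SubAlg) : Polynomial ℚ :=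
  eval (fun _ => (1 : Polynomial ℚ)) p

namespace SubdivisionAlgebra

/-- The exponent of `u_i u_{i+1} ⋯ u_{j-1}`: the unit flow from `i` to `j`. -/
noncomputable def unitFlow (i j : ℕ) : ℕ →₀ ℕ :=
  Finsupp.indicator (Finset.Ico i j) fun _ _ => 1

lemma unitFlow_apply (i j l : ℕ) : unitFlow i j l = if i ≤ l ∧ l < j then 1 else 0 := by
  simp [unitFlow, Finsupp.indicator_apply]

lemma unitFlow_ne_zero {i j : ℕ} (h : i < j) : unitFlow i j ≠ 0 := by
  intro h0
  simpa [unitFlow_apply, h] using DFunLike.congr_fun h0 i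

lemma unitFlow_add {i j k : ℕ} (hij : i < j) (hjk : j < k) :
    unitFlow i j + unitFlow j k = unitFlow i k := by
  ext l
  simp only [Finsupp.add_apply, unitFlow_apply]
  grind

/-- The geometric series `1 / (1 - u_i ⋯ u_{j-1})`. -/
noncomputable def geomSeries (i j : ℕ) : MvPowerSeries ℕ (Polynomial ℚ) :=
  MvPowerSeries.invOfUnit (1 - MvPowerSeries.monomial (unitFlow i j) 1) 1

lemma one_sub_mul_geomSeries {i j : ℕ} (h : i < j) :
    (1 - MvPowerSeries.monomial (unitFlow i j) (1 : Polynomial ℚ)) * geomSeries i j = 1 := by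
  classical
  refine MvPowerSeries.mul_invOfUnit _ _ ?_
  rw [map_sub, map_one, ← MvPowerSeries.coeff_zero_eq_constantCoeff_apply,
    MvPowerSeries.coeff_monomial, if_neg (unitFlow_ne_zero h).symm]
  simp

/-- The realization `x_{ij} ↦ -β / (1 - u_i ⋯ u_{j-1})` of the subdivision algebra. -/
noncomputable def toSeries : SubAlg →ₐ[Polynomial ℚ] MvPowerSeries ℕ (Polynomial ℚ) :=
  aeval fun e => (-Polynomial.X : Polynomial ℚ) • geomSeries e.1 e.2

lemma toSeries_relation {i j k : ℕ} (hij : i < j) (hjk : j < k) :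
    toSeries (X (i, k) * (X (i, j) + X (j, k) + C Polynomial.X) - X (i, j) * X (j, k)) = 0 := by
  have hu := one_sub_mul_geomSeries hij
  have hv := one_sub_mul_geomSeries hjk
  have hw := one_sub_mul_geomSeries (hij.trans hjk)
  have huv : MvPowerSeries.monomial (unitFlow i k) (1 : Polynomial ℚ) =
      MvPowerSeries.monomial (unitFlow i j) 1 * MvPowerSeries.monomial (unitFlow j k) 1 := by
    rw [MvPowerSeries.monomial_mul_monomial, unitFlow_add hij hjk, one_mul]
  have hC : (C Polynomial.X : SubAlg) = algebraMap _ _ Polynomial.X := rfl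
  rw [huv] at hw
  simp only [map_sub, map_add, map_mul, hC, AlgHom.commutes, toSeries, aeval_X,
    Algebra.smul_def, map_neg]
  generalize MvPowerSeries.monomial (unitFlow i j) (1 : Polynomial ℚ) = u at *
  generalize MvPowerSeries.monomial (unitFlow j k) (1 : Polynomial ℚ) = v at *
  generalize geomSeries i j = g at *
  generalize geomSeries j k = h at *
  generalize geomSeries i k = m at *
  generalize algebraMap (Polynomial ℚ) (MvPowerSeries ℕ (Polynomial ℚ)) Polynomial.X = b
  have hgh : g + h - 1 = g * h * (1 - u * v) := by
    linear_combination -(v * h) * hu - (g - 1) * hv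
  linear_combination b ^ 2 * m * hgh + b ^ 2 * g * h * hw

lemma toSeries_eq_of_reflTransGen {n : ℕ} {p q : SubAlg}
    (h : Relation.ReflTransGen (ReductionStep n) p q) : toSeries q = toSeries p := by
  induction h with
  | refl => rfl
  | tail _ hstep ih =>
    obtain ⟨i, j, k, -, hij, hjk, -, d, -, -, -, rfl⟩ := hstep
    rw [map_add, map_mul, toSeries_relation hij hjk, mul_zero, add_zero, ih]

/-- The pairs that may be edges of a graph on `{1, …, n}`. -/
def edges (n : ℕ) : Set (ℕ × ℕ) := {e | 1 ≤ e.1 ∧ e.1 < e.2 ∧ e.2 ≤ n}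

lemma mem_supported_of_reflTransGen {n : ℕ} {p q : SubAlg}
    (hp : p ∈ supported (Polynomial ℚ) (edges n))
    (h : Relation.ReflTransGen (ReductionStep n) p q) :
    q ∈ supported (Polynomial ℚ) (edges n) := by
  induction h with
  | refl => exact hp
  | @tail p _ _ hstep ih =>
    obtain ⟨i, j, k, hi, hij, hjk, hk, d, hd, -, -, rfl⟩ := hstep
    have hX {a b : ℕ} (h : (a, b) ∈ edges n) :
        (X (a, b) : SubAlg) ∈ supported (Polynomial ℚ) (edges n) :=
      Algebra.subset_adjoin ⟨_, h, rfl⟩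
    have hXij := hX (a := i) (b := j) ⟨hi, hij, by dsimp only; omega⟩
    have hXjk := hX (a := j) (b := k) ⟨by dsimp only; omega, hjk, hk⟩
    have hXik := hX (a := i) (b := k) ⟨hi, hij.trans hjk, hk⟩
    refine add_mem ih (mul_mem ?_ (sub_mem (mul_mem hXik (add_mem (add_mem hXij hXjk)
      (Subalgebra.algebraMap_mem _ _))) (mul_mem hXij hXjk)))
    rw [mem_supported] at ih ⊢
    intro e he
    rw [Finset.mem_coe, vars_monomial (mem_support_iff.mp hd), Finsupp.mem_support_iff] at he
    refine ih (Finset.mem_coe.mpr ((mem_vars_iff_mem_support _).mpr ⟨d, hd, ?_⟩))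
    rw [Finsupp.mem_support_iff]
    intro h0
    simp [h0] at he

/-- The total flow that a net flow with partial sums `a` draws from the sources. -/
def sourceFlow (n : ℕ) (a : ℕ →₀ ℕ) : ℕ := a 0 + ∑ l ∈ Finset.range n, (a (l + 1) - a l)

lemma apply_le_sourceFlow {n m : ℕ} (a : ℕ →₀ ℕ) (hm : m ≤ n) : a m ≤ sourceFlow n a := by
  have key : a m ≤ a 0 + ∑ l ∈ Finset.range m, (a (l + 1) - a l) := by
    clear hm
    induction m with
    | zero => simp
    | succ m ih => rw [Finset.sum_range_succ]; omega
  exact key.trans (Nat.add_le_add_left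
    (Finset.sum_le_sum_of_subset (Finset.range_subset_range.mpr hm)) _)

/-- The flows on `{1, …, n}` whose sources lie in `S` and whose sinks lie outside `S`. -/
def bipartiteFlows (n : ℕ) (S : Set ℕ) : AddSubmonoid (ℕ →₀ ℕ) where
  carrier := {a | (∀ l, n ≤ l → a l = 0) ∧
    ∀ l, (l + 1 ∈ S → a l ≤ a (l + 1)) ∧ (l + 1 ∉ S → a (l + 1) ≤ a l)}
  zero_mem' := by simp
  add_mem' := by
    rintro a b ⟨ha, ha'⟩ ⟨hb, hb'⟩
    refine ⟨fun l hl => by simp [ha l hl, hb l hl], fun l => ⟨fun h => ?_, fun h => ?_⟩⟩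
    · exact add_le_add ((ha' l).1 h) ((hb' l).1 h)
    · exact add_le_add ((ha' l).2 h) ((hb' l).2 h)

lemma unitFlow_mem_bipartiteFlows {n i j : ℕ} {S : Set ℕ} (hj : j ≤ n)
    (hiS : i ∈ S) (hjS : j ∉ S) : unitFlow i j ∈ bipartiteFlows n S := by
  refine ⟨fun l hl => ?_, fun l => ⟨fun h => ?_, fun h => ?_⟩⟩
  · rw [unitFlow_apply, if_neg (by omega)]
  · have : l + 1 ≠ j := fun h' => hjS (h' ▸ h)
    simp only [unitFlow_apply]
    grind
  · have : l + 1 ≠ i := fun h' => h (h' ▸ hiS)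
    simp only [unitFlow_apply]
    grind

lemma sourceFlow_unitFlow {n i j : ℕ} (hi : 1 ≤ i) (hij : i < j) (hj : j ≤ n) :
    sourceFlow n (unitFlow i j) = 1 := by
  rw [sourceFlow, Finset.sum_eq_single (i - 1)]
  · simp only [unitFlow_apply]
    grind
  · intro l _ hl
    simp only [unitFlow_apply]
    grind
  · intro h
    exact absurd (Finset.mem_range.mpr (by omega)) h

lemma sourceFlow_add {n : ℕ} {S : Set ℕ} {a b : ℕ →₀ ℕ} (ha : a ∈ bipartiteFlows n S)
    (hb : b ∈ bipartiteFlows n S) : sourceFlow n (a + b) = sourceFlow n a + sourceFlow n b := by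
  have key : ∑ l ∈ Finset.range n, ((a + b) (l + 1) - (a + b) l) =
      ∑ l ∈ Finset.range n, (a (l + 1) - a l) + ∑ l ∈ Finset.range n, (b (l + 1) - b l) := by
    rw [← Finset.sum_add_distrib]
    refine Finset.sum_congr rfl fun l _ => ?_
    have ha' := ha.2 l
    have hb' := hb.2 l
    simp only [Finsupp.add_apply]
    by_cases h : l + 1 ∈ S
    · have := ha'.1 h
      have := hb'.1 h
      omega
    · have := ha'.2 h
      have := hb'.2 h
      omega
  rw [sourceFlow, key, Finsupp.add_apply, sourceFlow, sourceFlow]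
  omega

/-- The flows with all partial sums at most `N`. -/
noncomputable def flowBox (n N : ℕ) : Finset (ℕ →₀ ℕ) :=
  Finset.finsupp (Finset.range n) fun _ => Finset.range (N + 1)

lemma mem_flowBox {n N : ℕ} {a : ℕ →₀ ℕ} :
    a ∈ flowBox n N ↔ (∀ l, n ≤ l → a l = 0) ∧ ∀ l, a l ≤ N := by
  rw [flowBox, Finset.mem_finsupp_iff]
  constructor
  · rintro ⟨h, h'⟩
    have h0 : ∀ l, n ≤ l → a l = 0 := fun l hl => by
      by_contra hne
      have := Finset.mem_range.mp (h (Finsupp.mem_support_iff.mpr hne))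
      omega
    refine ⟨h0, fun l => ?_⟩
    rcases lt_or_ge l n with hl | hl
    · have := Finset.mem_range.mp (h' l (Finset.mem_range.mpr hl))
      omega
    · simp [h0 l hl]
  · rintro ⟨h, h'⟩
    refine ⟨fun l hl => ?_, fun l _ => Finset.mem_range.mpr (Nat.lt_succ_of_le (h' l))⟩
    by_contra hne
    exact Finsupp.mem_support_iff.mp hl (h l (by simpa using hne))

lemma lt_sourceFlow_of_notMem_flowBox {n N : ℕ} {S : Set ℕ} {a : ℕ →₀ ℕ}
    (ha : a ∈ bipartiteFlows n S) (h : a ∉ flowBox n N) : N < sourceFlow n a := by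
  rw [mem_flowBox, not_and] at h
  obtain ⟨l, hl⟩ := not_forall.mp (h ha.1)
  rcases lt_or_ge l n with hln | hln
  · have := apply_le_sourceFlow a hln.le
    omega
  · simp [ha.1 l hln] at hl

/-- The truncated Ehrhart series: `u^a ↦ (β + 1) ^ sourceFlow a` for `a` in the box. -/
noncomputable def ehrhart (n N : ℕ) :
    MvPowerSeries ℕ (Polynomial ℚ) →ₗ[Polynomial ℚ] Polynomial ℚ :=
  ∑ a ∈ flowBox n N,
    ((Polynomial.X + 1) ^ sourceFlow n a : Polynomial ℚ) • MvPowerSeries.coeff a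

lemma ehrhart_apply (n N : ℕ) (F : MvPowerSeries ℕ (Polynomial ℚ)) :
    ehrhart n N F = ∑ a ∈ flowBox n N,
      (Polynomial.X + 1) ^ sourceFlow n a * MvPowerSeries.coeff a F := by
  simp [ehrhart, LinearMap.sum_apply]

lemma ehrhart_one (n N : ℕ) : ehrhart n N 1 = 1 := by
  classical
  rw [ehrhart_apply, Finset.sum_eq_single 0]
  · simp [sourceFlow]
  · intro a _ ha
    simp [MvPowerSeries.coeff_one, ha]
  · intro h
    exact absurd (mem_flowBox.mpr (by simp)) h

lemma dvd_ehrhart_monomial_mul {n N i j : ℕ} {S : Set ℕ} (hi : 1 ≤ i) (hij : i < j)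
    (hj : j ≤ n) (hiS : i ∈ S) (hjS : j ∉ S) {F : MvPowerSeries ℕ (Polynomial ℚ)}
    (hF : ∀ a, MvPowerSeries.coeff a F ≠ 0 → a ∈ bipartiteFlows n S) :
    (Polynomial.X + 1 : Polynomial ℚ) ^ (N + 1) ∣
      (Polynomial.X + 1) * ehrhart n N F -
        ehrhart n N (MvPowerSeries.monomial (unitFlow i j) 1 * F) := by
  classical
  have hU := unitFlow_mem_bipartiteFlows hj hiS hjS
  have hadd : ∀ a, MvPowerSeries.coeff a F ≠ 0 →
      sourceFlow n (a + unitFlow i j) = sourceFlow n a + 1 := fun a ha => by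
    rw [sourceFlow_add (hF a ha) hU, sourceFlow_unitFlow hi hij hj]
  have hshift : ehrhart n N (MvPowerSeries.monomial (unitFlow i j) 1 * F) =
      ∑ b ∈ flowBox n N with b + unitFlow i j ∈ flowBox n N,
        (Polynomial.X + 1) ^ sourceFlow n (b + unitFlow i j) * MvPowerSeries.coeff b F := by
    simp only [ehrhart_apply, MvPowerSeries.coeff_monomial_mul, one_mul, mul_ite, mul_zero]
    rw [← Finset.sum_filter]
    refine Finset.sum_nbij' (· - unitFlow i j) (· + unitFlow i j) ?_ ?_ ?_ ?_ ?_
    · intro a ha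
      obtain ⟨ha, hle⟩ := Finset.mem_filter.mp ha
      refine Finset.mem_filter.mpr ⟨?_, by rwa [tsub_add_cancel_of_le hle]⟩
      rw [mem_flowBox] at ha ⊢
      exact ⟨fun l hl => by simp [ha.1 l hl], fun l => (Nat.sub_le _ _).trans (ha.2 l)⟩
    · intro b hb
      exact Finset.mem_filter.mpr ⟨(Finset.mem_filter.mp hb).2, le_add_self⟩
    · intro a ha
      exact tsub_add_cancel_of_le (Finset.mem_filter.mp ha).2
    · intro b _
      exact add_tsub_cancel_right _ _
    · intro a ha
      rw [tsub_add_cancel_of_le (Finset.mem_filter.mp ha).2]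
  rw [hshift, ehrhart_apply, Finset.mul_sum, Finset.sum_filter, ← Finset.sum_sub_distrib]
  refine Finset.dvd_sum fun b _ => ?_
  by_cases hb : MvPowerSeries.coeff b F = 0
  · simp [hb]
  split_ifs with hmem
  · rw [hadd b hb, pow_succ]
    convert dvd_zero _ using 1
    ring
  · rw [sub_zero, ← mul_assoc, ← pow_succ', ← hadd b hb]
    exact (pow_dvd_pow _
      (lt_sourceFlow_of_notMem_flowBox (add_mem (hF b hb) hU) hmem)).mul_right _

/-- A series of bipartite flows with Ehrhart series `1` up to the truncation order. -/
def IsUnimodular (n N : ℕ) (S : Set ℕ) (F : MvPowerSeries ℕ (Polynomial ℚ)) : Prop :=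
  (∀ a, MvPowerSeries.coeff a F ≠ 0 → a ∈ bipartiteFlows n S) ∧
    (Polynomial.X + 1 : Polynomial ℚ) ^ (N + 1) ∣ ehrhart n N F - 1

lemma isUnimodular_one (n N : ℕ) (S : Set ℕ) : IsUnimodular n N S 1 := by
  classical
  refine ⟨fun a ha => ?_, by simp [ehrhart_one]⟩
  rw [MvPowerSeries.coeff_one] at ha
  rw [of_not_not fun h => ha (if_neg h)]
  exact zero_mem _

lemma IsUnimodular.mul_geomSeries {n N i j : ℕ} {S : Set ℕ} (hi : 1 ≤ i) (hij : i < j)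
    (hj : j ≤ n) (hiS : i ∈ S) (hjS : j ∉ S) {F : MvPowerSeries ℕ (Polynomial ℚ)}
    (hF : IsUnimodular n N S F) :
    IsUnimodular n N S (F * (-Polynomial.X : Polynomial ℚ) • geomSeries i j) := by
  classical
  set F' := F * (-Polynomial.X : Polynomial ℚ) • geomSeries i j with hF'
  have hrec : F' = (-Polynomial.X : Polynomial ℚ) • F +
      MvPowerSeries.monomial (unitFlow i j) 1 * F' := by
    have h := one_sub_mul_geomSeries hij
    simp only [hF', Algebra.smul_def]
    linear_combination (F * algebraMap (Polynomial ℚ) _ (-Polynomial.X)) * h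
  have hsupp : ∀ a, MvPowerSeries.coeff a F' ≠ 0 → a ∈ bipartiteFlows n S := by
    intro a
    induction a using WellFoundedLT.induction with
    | ind a ih =>
      intro ha
      rw [hrec, map_add, MvPowerSeries.coeff_monomial_mul, map_smul, one_mul] at ha
      by_cases hFa : MvPowerSeries.coeff a F = 0
      · rw [hFa, smul_zero, zero_add] at ha
        obtain ⟨hle, hne⟩ := ite_ne_right_iff.mp ha
        have hlt : a - unitFlow i j < a := by
          refine lt_of_le_of_ne tsub_le_self fun h => unitFlow_ne_zero hij ?_
          simpa [h] using tsub_add_cancel_of_le hle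
        rw [← tsub_add_cancel_of_le hle]
        exact add_mem (ih _ hlt hne) (unitFlow_mem_bipartiteFlows hj hiS hjS)
      · exact hF.1 a hFa
  refine ⟨hsupp, ?_⟩
  have hdvd := dvd_ehrhart_monomial_mul (N := N) hi hij hj hiS hjS hsupp
  have hsum := congrArg (ehrhart n N) hrec
  rw [map_add, map_smul, smul_eq_mul] at hsum
  have hX : (Polynomial.X + 1 : Polynomial ℚ) ^ (N + 1) ∣
      Polynomial.X * (ehrhart n N F' - ehrhart n N F) := by
    convert hdvd using 1
    linear_combination -hsum
  have hcop : IsCoprime ((Polynomial.X + 1 : Polynomial ℚ) ^ (N + 1)) Polynomial.X :=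
    IsCoprime.pow_left ⟨1, -1, by ring⟩
  simpa using dvd_add (hcop.dvd_of_dvd_mul_left hX) hF.2

lemma isUnimodular_toSeries_monomial {n N : ℕ} {S : Set ℕ} (d : ℕ × ℕ →₀ ℕ)
    (hd : ∀ e ∈ d.support, e ∈ edges n ∧ e.1 ∈ S ∧ e.2 ∉ S) :
    IsUnimodular n N S (toSeries (monomial d 1)) := by
  classical
  rw [toSeries, aeval_monomial, map_one, one_mul, Finsupp.prod]
  generalize d.support = T at hd
  induction T using Finset.induction_on with
  | empty => exact isUnimodular_one n N S
  | insert e T he ih =>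
    obtain ⟨⟨hi, hij, hj⟩, hiS, hjS⟩ := hd e (Finset.mem_insert_self e T)
    specialize ih fun e' h => hd e' (Finset.mem_insert_of_mem h)
    rw [Finset.prod_insert he, mul_comm]
    induction d e with
    | zero => simpa using ih
    | succ m ihm =>
      rw [pow_succ, ← mul_assoc]
      exact ihm.mul_geomSeries hi hij hj hiS hjS

lemma dvd_ehrhart_sub_specializeOne {n : ℕ} (N : ℕ) {q : SubAlg}
    (hq : q ∈ supported (Polynomial ℚ) (edges n)) (hred : ∀ r, ¬ ReductionStep n q r) :
    (Polynomial.X + 1 : Polynomial ℚ) ^ (N + 1) ∣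
      ehrhart n N (toSeries q) - specializeOne q := by
  have hL : ehrhart n N (toSeries q) =
      ∑ d ∈ q.support, q.coeff d * ehrhart n N (toSeries (monomial d 1)) := by
    conv_lhs => rw [q.as_sum]
    simp only [map_sum]
    refine Finset.sum_congr rfl fun d _ => ?_
    rw [← smul_eq_mul, ← map_smul, ← map_smul, smul_monomial, smul_eq_mul, mul_one]
  have hR : specializeOne q = ∑ d ∈ q.support, q.coeff d := by
    simp [specializeOne, eval_eq]
  rw [hL, hR, ← Finset.sum_sub_distrib]
  refine Finset.dvd_sum fun d hd => ?_
  have hedge : ∀ e, d e ≠ 0 → e ∈ edges n := fun e he =>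
    mem_supported.mp hq (Finset.mem_coe.mpr ((mem_vars_iff_mem_support _).mpr
      ⟨d, hd, Finsupp.mem_support_iff.mpr he⟩))
  have huni : IsUnimodular n N {i | ∃ j, d (i, j) ≠ 0} (toSeries (monomial d 1)) := by
    refine isUnimodular_toSeries_monomial d fun e he => ?_
    rw [Finsupp.mem_support_iff] at he
    refine ⟨hedge e he, ⟨e.2, he⟩, ?_⟩
    rintro ⟨k, hk⟩
    exact hred _ ⟨e.1, e.2, k, (hedge e he).1, (hedge e he).2.1, (hedge _ hk).2.1,
      (hedge _ hk).2.2, d, hd, Nat.one_le_iff_ne_zero.mpr he, Nat.one_le_iff_ne_zero.mpr hk, rfl⟩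
  simpa only [mul_sub, mul_one] using huni.2.mul_left (q.coeff d)

lemma eq_of_forall_pow_dvd_sub {p q : Polynomial ℚ}
    (h : ∀ N, (Polynomial.X + 1 : Polynomial ℚ) ^ (N + 1) ∣ p - q) : p = q := by
  refine sub_eq_zero.mp (Polynomial.eq_zero_of_dvd_of_natDegree_lt (h (p - q).natDegree) ?_)
  rw [← Polynomial.C_1, Polynomial.natDegree_pow, Polynomial.natDegree_X_add_C]
  omega

end SubdivisionAlgebra

open SubdivisionAlgebra

/-- For a graph `G` on `{1,…,n}`, any two reduced forms of the monomial
`∏_{(i,j) ∈ E(G)} x_{ij}` in the subdivision algebra agree after setting all `x_{ij} = 1`;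
i.e. the specialized reduced form `Q_G(β)` is well-defined. -/
theorem reduced_form_well_defined (n : ℕ) (E : Finset (ℕ × ℕ))
    (hE : ∀ p ∈ E, 1 ≤ p.1 ∧ p.1 < p.2 ∧ p.2 ≤ n)
    (q q' : SubAlg)
    (hq : IsReducedForm n (∏ e ∈ E, X e) q)
    (hq' : IsReducedForm n (∏ e ∈ E, X e) q') :
    specializeOne q = specializeOne q' := by
  have hE' : ∏ e ∈ E, (X e : SubAlg) ∈ supported (Polynomial ℚ) (edges n) :=
    prod_mem fun e he => Algebra.subset_adjoin ⟨e, hE e he, rfl⟩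
  refine eq_of_forall_pow_dvd_sub fun N => ?_
  have h := dvd_ehrhart_sub_specializeOne N (mem_supported_of_reflTransGen hE' hq.1) hq.2
  have h' := dvd_ehrhart_sub_specializeOne N (mem_supported_of_reflTransGen hE' hq'.1) hq'.2
  rw [toSeries_eq_of_reflTransGen hq.1] at h
  rw [toSeries_eq_of_reflTransGen hq'.1] at h'
  simpa using dvd_sub h' h
end
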